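/- Consider a two-player extensive-form game (as in the model below) satisfying perfect recall. Let v ∈ 𝒱 be such that every coordinate of v lies in {0, 1}. Then there exist reduced-normal-form plans π₁* ∈ Π₁ and π₂* ∈ Π₂ such that v = f(𝟙_{(π₁*,π₂*)}), where 𝟙_{(π₁*,π₂*)} is the probability distribution on Π₁ × Π₂ assigning mass 1 to (π₁*, π₂*). In particular, every element of 𝒱 with all coordinates in {0, 1} belongs to Ξ. -/

import Mathlib

open scoped Classical

/-- The type of "sequences" of a player: `none` is the empty sequence `∅`, and
`some (I, a)` is the sequence consisting of information set `I` (a set of nodes)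
together with action `a` at `I`. -/
abbrev SeqP := Option (Set (List ℕ) × ℕ)

/-- The type of (candidate) reduced-normal-form plans: partial functions from
information sets to actions, encoded with `Option`. -/
abbrev PlanT := Set (List ℕ) → Option ℕ

/-- Two information sets (of the two players) are connected, `I ⇌ J`, if some node
of one is a prefix of some node of the other. -/
def Connected (I J : Set (List ℕ)) : Prop := ∃ u ∈ I, ∃ v ∈ J, u <+: v ∨ v <+: u

/-- A two-player extensive-form game.  Nodes are histories (finite lists of naturals),
`H` is the finite, prefix-closed set of nodes.  The two players are `0` and `1`
(as elements of `Fin 2`, embedded into `Fin 3` via `Fin.castSucc`), and an internal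
node `u` with `owner u = 2` is a chance node.  `sim i` is the information-partition
equivalence relation of player `i` on the internal nodes owned by player `i`. -/
structure EFG where
  H : Finset (List ℕ)
  root_mem : ([] : List ℕ) ∈ H
  prefix_closed : ∀ u v : List ℕ, u <+: v → v ∈ H → u ∈ H
  owner : List ℕ → Fin 3
  sim : Fin 2 → List ℕ → List ℕ → Prop
  sim_mem : ∀ i u v, sim i u v → (∃ a, u ++ [a] ∈ H) ∧ owner u = Fin.castSucc i
  sim_refl : ∀ i u, (∃ a, u ++ [a] ∈ H) → owner u = Fin.castSucc i → sim i u u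
  sim_symm : ∀ i u v, sim i u v → sim i v u
  sim_trans : ∀ i u v w, sim i u v → sim i v w → sim i u w
  sim_actions : ∀ i u v, sim i u v → ∀ a : ℕ, u ++ [a] ∈ H ↔ v ++ [a] ∈ H

namespace EFG

variable (G : EFG)

/-- A node is internal if it has at least one child in the tree. -/
def Internal (u : List ℕ) : Prop := ∃ a, u ++ [a] ∈ G.H

/-- The (finite) set of actions `A(u) = {a : u ++ [a] ∈ H}` available at node `u`. -/
noncomputable def actions (u : List ℕ) : Finset ℕ :=
  (G.H.finite_toSet.preimage (f := fun a : ℕ => u ++ [a])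
    (fun a _ b _ hab => by simpa using hab)).toFinset

/-- `I` is an information set of player `i`: an equivalence class of `sim i`. -/
def InfoSet (i : Fin 2) (I : Set (List ℕ)) : Prop :=
  ∃ u, G.sim i u u ∧ I = {v | G.sim i u v}

/-- `seqᵢ(u)`: the list (ordered by increasing length of the prefix `w`) of pairs
`(I, a)` such that `w ++ [a] ≼ u` for some internal node `w` owned by player `i`
whose information set is `I`. -/
noncomputable def playerSeq (i : Fin 2) (u : List ℕ) : List (Set (List ℕ) × ℕ) :=
  (List.range u.length).filterMap fun k =>
    if G.Internal (u.take k) ∧ G.owner (u.take k) = Fin.castSucc i then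
      some ({v | G.sim i (u.take k) v}, u.getD k 0)
    else none

/-- Perfect recall: nodes in the same information set have the same player sequence. -/
def PerfectRecall : Prop := ∀ i u v, G.sim i u v → G.playerSeq i u = G.playerSeq i v

/-- The parent sequence `σ(I)` of an information set `I` of player `i`: the last
element of `seqᵢ(u)` for `u ∈ I` (`none` encodes the empty sequence `∅`). -/
noncomputable def parentSeq (i : Fin 2) (I : Set (List ℕ)) : SeqP :=
  if h : ∃ u, u ∈ I then (G.playerSeq i h.choose).getLast? else none

/-- All chance moves are public: any two nodes in the same information set have
the same set of chance moves (pairs of a chance node and an action) on their paths. -/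
def PublicChance : Prop :=
  ∀ i u v, G.sim i u v →
    {p : List ℕ × ℕ | G.Internal p.1 ∧ G.owner p.1 = 2 ∧ p.1 ++ [p.2] <+: u} =
    {p : List ℕ × ℕ | G.Internal p.1 ∧ G.owner p.1 = 2 ∧ p.1 ++ [p.2] <+: v}

/-- Triangle-freeness of the game. -/
def TriangleFree : Prop :=
  ¬ ∃ I₁ I₂ J₁ J₂ : Set (List ℕ),
      G.InfoSet 0 I₁ ∧ G.InfoSet 0 I₂ ∧ G.InfoSet 1 J₁ ∧ G.InfoSet 1 J₂ ∧
      I₁ ≠ I₂ ∧ J₁ ≠ J₂ ∧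
      G.parentSeq 0 I₁ = G.parentSeq 0 I₂ ∧ G.parentSeq 1 J₁ = G.parentSeq 1 J₂ ∧
      Connected I₁ J₁ ∧ Connected I₂ J₂ ∧ Connected I₁ J₂

/-- `σ` is a member of `Σᵢ`, the set of sequences of player `i`. -/
def IsSeq (i : Fin 2) (σ : SeqP) : Prop :=
  σ = none ∨ ∃ I a, σ = some (I, a) ∧ G.InfoSet i I ∧ ∃ u ∈ I, u ++ [a] ∈ G.H

/-- `(σ₁, σ₂)` is a relevant sequence pair, `σ₁ ⇌ σ₂`. -/
def RelPair (σ₁ σ₂ : SeqP) : Prop :=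
  G.IsSeq 0 σ₁ ∧ G.IsSeq 1 σ₂ ∧
    (σ₁ = none ∨ σ₂ = none ∨
      ∃ I₁ a₁ I₂ a₂, σ₁ = some (I₁, a₁) ∧ σ₂ = some (I₂, a₂) ∧ Connected I₁ I₂)

/-- `σ₂ ∈ Σ₂` is relevant for the player-1 information set `I₁`. -/
def RelFor₁ (σ₂ : SeqP) (I₁ : Set (List ℕ)) : Prop :=
  σ₂ = none ∨ ∃ I₂ a₂, σ₂ = some (I₂, a₂) ∧ Connected I₁ I₂

/-- `σ₁ ∈ Σ₁` is relevant for the player-2 information set `I₂`. -/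
def RelFor₂ (σ₁ : SeqP) (I₂ : Set (List ℕ)) : Prop :=
  σ₁ = none ∨ ∃ I₁ a₁, σ₁ = some (I₁, a₁) ∧ Connected I₁ I₂

/-- The index set of correlation plans: the relevant sequence pairs `Σ₁ ⇌ Σ₂`. -/
abbrev Idx := {p : SeqP × SeqP // G.RelPair p.1 p.2}

/-- The entry of a vector `v` indexed by relevant pairs at the pair `(σ₁, σ₂)`
(and `0` at irrelevant pairs, which never occur in the constraints below). -/
noncomputable def val (v : G.Idx → ℝ) (σ₁ σ₂ : SeqP) : ℝ :=
  if h : G.RelPair σ₁ σ₂ then v ⟨(σ₁, σ₂), h⟩ else 0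

/-- The von Stengel–Forges polytope `𝒱`. -/
def VSF : Set (G.Idx → ℝ) :=
  {v | (∀ p, 0 ≤ v p) ∧
    G.val v none none = 1 ∧
    (∀ I₁, G.InfoSet 0 I₁ → ∀ σ₂, G.IsSeq 1 σ₂ → RelFor₁ σ₂ I₁ → ∀ u ∈ I₁,
      ∑ a ∈ G.actions u, G.val v (some (I₁, a)) σ₂ = G.val v (G.parentSeq 0 I₁) σ₂) ∧
    (∀ I₂, G.InfoSet 1 I₂ → ∀ σ₁, G.IsSeq 0 σ₁ → RelFor₂ σ₁ I₂ → ∀ u ∈ I₂,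
      ∑ a ∈ G.actions u, G.val v σ₁ (some (I₂, a)) = G.val v σ₁ (G.parentSeq 1 I₂))}

/-- `π` is a reduced-normal-form plan for player `i`. -/
def IsPlan (i : Fin 2) (π : PlanT) : Prop :=
  (∀ I, ¬ G.InfoSet i I → π I = none) ∧
  (∀ I, G.InfoSet i I →
    ((π I).isSome = true ↔ ∀ u ∈ I, ∀ p ∈ G.playerSeq i u, π p.1 = some p.2)) ∧
  (∀ I a, G.InfoSet i I → π I = some a → ∃ u ∈ I, u ++ [a] ∈ G.H)

/-- `Πᵢ(σ)`: the set of reduced-normal-form plans of player `i` compatible with `σ`. -/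
def PlanSet (i : Fin 2) : SeqP → Set PlanT
  | none => {π | G.IsPlan i π}
  | some (I, a) => {π | G.IsPlan i π ∧ π I = some a}

/-- `μ` is a probability distribution on `Π₁ × Π₂`. -/
def IsDist (μ : PlanT × PlanT → ℝ) : Prop :=
  (∀ q, 0 ≤ μ q) ∧ (Function.support μ).Finite ∧
  (∀ q, μ q ≠ 0 → G.IsPlan 0 q.1 ∧ G.IsPlan 1 q.2) ∧
  ∑ᶠ q, μ q = 1

/-- The linear map `f` from distributions on `Π₁ × Π₂` to correlation plans. -/
noncomputable def corrMap (μ : PlanT × PlanT → ℝ) : G.Idx → ℝ :=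
  fun p => ∑ᶠ q ∈ {q : PlanT × PlanT | q.1 ∈ G.PlanSet 0 p.1.1 ∧ q.2 ∈ G.PlanSet 1 p.1.2}, μ q

/-- The polytope of correlation plans `Ξ`: the image of the probability distributions
on `Π₁ × Π₂` under `f`. -/
def corrPoly : Set (G.Idx → ℝ) := {x | ∃ μ, G.IsDist μ ∧ x = G.corrMap μ}

/-- The `σ₁`-rank of a player-2 information set `I₂`: the number of player-1
information sets connected to `I₂` whose parent sequence is `σ₁`. -/
noncomputable def rank₁ (σ₁ : SeqP) (I₂ : Set (List ℕ)) : ℕ :=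
  Nat.card {J : Set (List ℕ) // G.InfoSet 0 J ∧ Connected J I₂ ∧ G.parentSeq 0 J = σ₁}

/-- The `σ₂`-rank of a player-1 information set `I₁`: the number of player-2
information sets connected to `I₁` whose parent sequence is `σ₂`. -/
noncomputable def rank₂ (σ₂ : SeqP) (I₁ : Set (List ℕ)) : ℕ :=
  Nat.card {J : Set (List ℕ) // G.InfoSet 1 J ∧ Connected I₁ J ∧ G.parentSeq 1 J = σ₂}

end EFG

/-- The point-mass distribution `𝟙_{q₀}` on pairs of plans. -/
noncomputable def pointMass (q₀ : PlanT × PlanT) : PlanT × PlanT → ℝ :=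
  fun q => if q = q₀ then 1 else 0

namespace EFG

variable (G : EFG)

theorem mem_actions {u : List ℕ} {a : ℕ} : a ∈ G.actions u ↔ u ++ [a] ∈ G.H := by
  simp [actions]

variable {G}

theorem setOf_sim_eq {i : Fin 2} {u w : List ℕ} (h : G.sim i u w) :
    {z | G.sim i u z} = {z | G.sim i w z} := by
  ext z
  exact ⟨fun hz => G.sim_trans _ _ _ _ (G.sim_symm _ _ _ h) hz,
    fun hz => G.sim_trans _ _ _ _ h hz⟩

theorem sim_self_of_sim {i : Fin 2} {u w : List ℕ} (h : G.sim i u w) : G.sim i w w :=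
  G.sim_trans _ _ _ _ (G.sim_symm _ _ _ h) h

/-- An information set is the class of each of its members. -/
theorem InfoSet.eq_of_mem {i : Fin 2} {I : Set (List ℕ)} (hI : G.InfoSet i I) {u : List ℕ}
    (hu : u ∈ I) : G.sim i u u ∧ I = {z | G.sim i u z} := by
  obtain ⟨w, -, rfl⟩ := hI
  exact ⟨sim_self_of_sim hu, setOf_sim_eq hu⟩

theorem playerSeq_append_singleton (i : Fin 2) (u : List ℕ) (a : ℕ) :
    G.playerSeq i (u ++ [a]) = G.playerSeq i u ++
      if G.Internal u ∧ G.owner u = Fin.castSucc i then [({z | G.sim i u z}, a)] else [] := by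
  unfold playerSeq
  rw [List.length_append, List.length_singleton, List.range_succ, List.filterMap_append]
  congr 1
  · apply List.filterMap_congr
    intro k hk
    have hk' : k < u.length := List.mem_range.1 hk
    rw [List.take_append_of_le_length hk'.le, List.getD_append _ _ _ _ hk']
  · simp only [List.filterMap_cons, List.filterMap_nil, List.take_left']
    split_ifs with h <;> simp

/-- Either a player has not moved on the way to `u`, or there is a last node at which the
player has moved. -/
theorem playerSeq_eq_nil_or (i : Fin 2) (u : List ℕ) (hu : u ∈ G.H) :
    G.playerSeq i u = [] ∨ ∃ w b, w ++ [b] <+: u ∧ G.sim i w w ∧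
      G.playerSeq i u = G.playerSeq i w ++ [({z | G.sim i w z}, b)] := by
  induction u using List.reverseRecOn with
  | nil => left; simp [playerSeq]
  | append_singleton u a ih =>
    rw [playerSeq_append_singleton]
    split_ifs with h
    · exact Or.inr ⟨u, a, List.prefix_rfl, G.sim_refl _ _ h.1 h.2, rfl⟩
    · rw [List.append_nil]
      refine (ih (G.prefix_closed _ _ (List.prefix_append _ _) hu)).imp_right ?_
      rintro ⟨w, b, hw, h1, h2⟩
      exact ⟨w, b, hw.trans (List.prefix_append _ _), h1, h2⟩

theorem parentSeq_setOf_sim (hpr : G.PerfectRecall) {i : Fin 2} {u : List ℕ}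
    (hu : G.sim i u u) :
    G.parentSeq i {z | G.sim i u z} = (G.playerSeq i u).getLast? := by
  have h : ∃ w, w ∈ {z | G.sim i u z} := ⟨u, hu⟩
  rw [parentSeq, dif_pos h, ← hpr i u _ h.choose_spec]

theorem mem_H_of_sim {i : Fin 2} {u w : List ℕ} (hu : G.sim i u w) : u ∈ G.H := by
  obtain ⟨a, ha⟩ := (G.sim_mem _ _ _ hu).1
  exact G.prefix_closed _ _ (List.prefix_append _ _) ha

theorem parentSeq_cases (hpr : G.PerfectRecall) {i : Fin 2} {u : List ℕ} (hu : G.sim i u u) :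
    (G.playerSeq i u = [] ∧ G.parentSeq i {z | G.sim i u z} = none) ∨
    ∃ w b, w ++ [b] <+: u ∧ w ++ [b] ∈ G.H ∧ G.sim i w w ∧
      G.playerSeq i u = G.playerSeq i w ++ [({z | G.sim i w z}, b)] ∧
      G.parentSeq i {z | G.sim i u z} = some ({z | G.sim i w z}, b) := by
  rw [parentSeq_setOf_sim hpr hu]
  rcases playerSeq_eq_nil_or i u (mem_H_of_sim hu) with h | ⟨w, b, h1, h2, h3⟩
  · exact Or.inl ⟨h, by simp [h]⟩
  · exact Or.inr ⟨w, b, h1, G.prefix_closed _ _ h1 (mem_H_of_sim hu), h2, h3, by simp [h3]⟩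

theorem IsSeq.exists_of_some {i : Fin 2} {I : Set (List ℕ)} {a : ℕ}
    (h : G.IsSeq i (some (I, a))) : G.InfoSet i I ∧ ∃ u ∈ I, u ++ [a] ∈ G.H := by
  rcases h with h | ⟨J, b, h, hJ, hb⟩
  · simp at h
  · obtain ⟨rfl, rfl⟩ : I = J ∧ a = b := by simpa using h
    exact ⟨hJ, hb⟩

/-- A pure realization plan of the sequence form is induced by a reduced-normal-form plan. -/
theorem exists_isPlan_of_sequenceForm (hpr : G.PerfectRecall) (i : Fin 2) (x : SeqP → ℝ)
    (x_none : x none = 1) (x_zero_one : ∀ σ, x σ = 0 ∨ x σ = 1)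
    (x_sum : ∀ I, G.InfoSet i I → ∀ u ∈ I,
      ∑ a ∈ G.actions u, x (some (I, a)) = x (G.parentSeq i I)) :
    ∃ π, G.IsPlan i π ∧ ∀ σ, G.IsSeq i σ → (x σ = 1 ↔ π ∈ G.PlanSet i σ) := by
  have x_nonneg : ∀ σ, 0 ≤ x σ := fun σ => by rcases x_zero_one σ with h | h <;> simp [h]
  have x_le_one : ∀ σ, x σ ≤ 1 := fun σ => by rcases x_zero_one σ with h | h <;> simp [h]
  let P : Set (List ℕ) → ℕ → Prop := fun I a =>
    G.InfoSet i I ∧ (∃ u ∈ I, u ++ [a] ∈ G.H) ∧ x (some (I, a)) = 1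
  have P_unique : ∀ I a b, P I a → P I b → a = b := by
    rintro I a b ⟨hI, ⟨u, hu, hua⟩, ha⟩ ⟨-, ⟨w, hw, hwb⟩, hb⟩
    by_contra hne
    obtain ⟨-, rfl⟩ := hI.eq_of_mem hu
    have hub := (G.sim_actions _ _ _ hw b).2 hwb
    have hsum := x_sum _ hI u hu
    have hle : ∑ c ∈ {a, b}, x (some ({z | G.sim i u z}, c)) ≤
        ∑ c ∈ G.actions u, x (some ({z | G.sim i u z}, c)) :=
      Finset.sum_le_sum_of_subset_of_nonneg
        (by intro c hc
            rcases Finset.mem_insert.1 hc with rfl | hc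
            · exact G.mem_actions.2 hua
            · rw [Finset.mem_singleton.1 hc]; exact G.mem_actions.2 hub)
        (fun _ _ _ => x_nonneg _)
    rw [Finset.sum_pair hne, hsum, ha, hb] at hle
    linarith [x_le_one (G.parentSeq i {z | G.sim i u z})]
  let π : PlanT := fun I => if h : ∃ a, P I a then some h.choose else none
  have π_iff : ∀ I a, π I = some a ↔ P I a := by
    intro I a
    by_cases h : ∃ a, P I a
    · simp only [π, dif_pos h, Option.some.injEq]
      exact ⟨fun e => e ▸ h.choose_spec, P_unique _ _ _ h.choose_spec⟩
    · simp only [π, dif_neg h]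
      exact ⟨fun e => by simp at e, fun e => (h ⟨a, e⟩).elim⟩
  have x_le_parent : ∀ u a, G.sim i u u → u ++ [a] ∈ G.H →
      x (some ({z | G.sim i u z}, a)) ≤ x (G.parentSeq i {z | G.sim i u z}) := by
    intro u a hu ha
    rw [← x_sum _ ⟨u, hu, rfl⟩ u hu]
    exact Finset.single_le_sum (f := fun c => x (some ({z | G.sim i u z}, c)))
      (fun _ _ => x_nonneg _) (G.mem_actions.2 ha)
  have parent_iff : ∀ n u, u.length = n → G.sim i u u →
      (x (G.parentSeq i {z | G.sim i u z}) = 1 ↔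
        ∀ p ∈ G.playerSeq i u, π p.1 = some p.2) := by
    intro n
    induction n using Nat.strong_induction_on with
    | _ n ih =>
      intro u hn hu
      rcases parentSeq_cases hpr hu with ⟨h1, h2⟩ | ⟨w, b, hwu, hwb, hw, h1, h2⟩
      · simp [h1, h2, x_none]
      · rw [h1, h2]
        have hlen : w.length < n := by
          have := hwu.length_le
          simp at this
          omega
        constructor
        · intro hx p hp
          rcases List.mem_append.1 hp with hp | hp
          · refine (ih _ hlen w rfl hw).1 (le_antisymm (x_le_one _) ?_) p hp
            exact hx ▸ x_le_parent w b hw hwb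
          · rw [List.mem_singleton.1 hp, π_iff]
            exact ⟨⟨w, hw, rfl⟩, ⟨w, hw, hwb⟩, hx⟩
        · intro h
          exact ((π_iff _ _).1 (h ({z | G.sim i w z}, b) (by simp))).2.2
  have isSome_iff : ∀ u, G.sim i u u →
      ((π {z | G.sim i u z}).isSome = true ↔ x (G.parentSeq i {z | G.sim i u z}) = 1) := by
    intro u hu
    rw [Option.isSome_iff_exists]
    constructor
    · rintro ⟨a, ha⟩
      obtain ⟨-, ⟨w, hw, hwa⟩, hx⟩ := (π_iff _ _).1 ha
      exact le_antisymm (x_le_one _)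
        (hx ▸ x_le_parent u a hu ((G.sim_actions _ _ _ hw a).2 hwa))
    · intro hx
      rw [← x_sum _ ⟨u, hu, rfl⟩ u hu] at hx
      obtain ⟨a, ha, hne⟩ := Finset.exists_ne_zero_of_sum_ne_zero (hx ▸ one_ne_zero)
      exact ⟨a, (π_iff _ _).2 ⟨⟨u, hu, rfl⟩, ⟨u, hu, G.mem_actions.1 ha⟩,
        (x_zero_one _).resolve_left hne⟩⟩
  have hπ : G.IsPlan i π := by
    refine ⟨fun I hI => dif_neg fun ⟨a, ha⟩ => hI ha.1, ?_,
      fun I a _ h => ((π_iff I a).1 h).2.1⟩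
    rintro I ⟨u, hu, rfl⟩
    rw [isSome_iff u hu, parent_iff _ u rfl hu]
    refine ⟨fun h w hw => ?_, fun h => h u hu⟩
    rwa [← hpr i u w hw]
  refine ⟨π, hπ, ?_⟩
  rintro (_ | ⟨I, a⟩) hσ
  · exact iff_of_true x_none hπ
  · obtain ⟨hI, ha⟩ := hσ.exists_of_some
    refine ⟨fun h => ⟨hπ, (π_iff I a).2 ⟨hI, ha, h⟩⟩, fun h => ((π_iff I a).1 h.2).2.2⟩

variable {v : G.Idx → ℝ}

theorem val_nonneg (hv : v ∈ G.VSF) (σ₁ σ₂ : SeqP) : 0 ≤ G.val v σ₁ σ₂ := by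
  unfold val
  split_ifs
  exacts [hv.1 _, le_rfl]

theorem val_eq_zero_or_one (hint : ∀ p : G.Idx, v p = 0 ∨ v p = 1) (σ₁ σ₂ : SeqP) :
    G.val v σ₁ σ₂ = 0 ∨ G.val v σ₁ σ₂ = 1 := by
  unfold val
  split_ifs
  exacts [hint _, Or.inl rfl]

/-- Entries of a point of `𝒱` are bounded by the marginal of the second player. -/
theorem val_le_val_none (hpr : G.PerfectRecall) (hv : v ∈ G.VSF) (σ₁ σ₂ : SeqP) :
    G.val v σ₁ σ₂ ≤ G.val v none σ₂ := by
  suffices H : ∀ n u a, u.length = n → G.sim 0 u u → u ++ [a] ∈ G.H →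
      G.val v (some ({z | G.sim 0 u z}, a)) σ₂ ≤ G.val v none σ₂ by
    by_cases h : G.RelPair σ₁ σ₂
    · rcases σ₁ with _ | ⟨I, a⟩
      · exact le_rfl
      · obtain ⟨hI, u, hu, ha⟩ := h.1.exists_of_some
        obtain ⟨hu', rfl⟩ := hI.eq_of_mem hu
        exact H _ u a rfl hu' ha
    · rw [val, dif_neg h]
      exact val_nonneg hv _ _
  intro n
  induction n using Nat.strong_induction_on with
  | _ n ih =>
    intro u a hn hu ha
    by_cases h : G.RelPair (some ({z | G.sim 0 u z}, a)) σ₂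
    · have hrel : RelFor₁ σ₂ {z | G.sim 0 u z} := by
        rcases h.2.2 with h | h | ⟨I₁, a₁, I₂, a₂, h1, h2, h3⟩
        · simp at h
        · exact Or.inl h
        · obtain ⟨rfl, rfl⟩ : {z | G.sim 0 u z} = I₁ ∧ a = a₁ := by simpa using h1
          exact Or.inr ⟨I₂, a₂, h2, h3⟩
      have hsum := hv.2.2.1 _ ⟨u, hu, rfl⟩ σ₂ h.2.1 hrel u hu
      have hle : G.val v (some ({z | G.sim 0 u z}, a)) σ₂ ≤
          G.val v (G.parentSeq 0 {z | G.sim 0 u z}) σ₂ := by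
        rw [← hsum]
        exact Finset.single_le_sum (f := fun c => G.val v (some ({z | G.sim 0 u z}, c)) σ₂)
          (fun _ _ => val_nonneg hv _ _) (G.mem_actions.2 ha)
      rcases parentSeq_cases hpr hu with ⟨-, h2⟩ | ⟨w, b, hwu, hwb, hw, -, h2⟩
      · rwa [h2] at hle
      · have hlen : w.length < n := by
          have := hwu.length_le
          simp at this
          omega
        rw [h2] at hle
        exact hle.trans (ih _ hlen w b rfl hw hwb)
    · rw [val, dif_neg h]
      exact val_nonneg hv _ _

/-- A zero-one point of `𝒱` is the product of its marginals. -/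
theorem val_eq_mul (hpr : G.PerfectRecall) (hv : v ∈ G.VSF)
    (hint : ∀ p : G.Idx, v p = 0 ∨ v p = 1) {σ₁ σ₂ : SeqP} (hrel : G.RelPair σ₁ σ₂) :
    G.val v σ₁ σ₂ = G.val v σ₁ none * G.val v none σ₂ := by
  rcases hrel with ⟨hσ₁, hσ₂, rfl | rfl | ⟨I₁, a₁, I₂, a₂, rfl, rfl, hconn⟩⟩
  · rw [hv.2.1, one_mul]
  · rw [hv.2.1, mul_one]
  obtain ⟨hI₂, w₀, hw₀, hwa₀⟩ := hσ₂.exists_of_some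
  suffices H : ∀ n u a, (G.playerSeq 1 u).length = n → G.sim 1 u u → u ++ [a] ∈ G.H →
      (∃ y ∈ I₁, y <+: u ∨ u <+: y) →
      G.val v (some (I₁, a₁)) (some ({z | G.sim 1 u z}, a)) =
        G.val v (some (I₁, a₁)) none * G.val v none (some ({z | G.sim 1 u z}, a)) by
    obtain ⟨y, hy, u, hu, hyu⟩ := hconn
    obtain ⟨hu', rfl⟩ := hI₂.eq_of_mem hu
    exact H _ u a₂ rfl hu' ((G.sim_actions _ _ _ hw₀ a₂).2 hwa₀) ⟨y, hy, hyu⟩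
  intro n
  induction n using Nat.strong_induction_on with
  | _ n ih =>
    rintro u a hn hu ha ⟨y, hy, hyu⟩
    have hparent : G.val v (some (I₁, a₁)) (G.parentSeq 1 {z | G.sim 1 u z}) =
        G.val v (some (I₁, a₁)) none * G.val v none (G.parentSeq 1 {z | G.sim 1 u z}) := by
      rcases parentSeq_cases hpr hu with ⟨-, h2⟩ | ⟨w, b, hwu, hwb, hw, h1, h2⟩
      · rw [h2, hv.2.1, mul_one]
      · rw [h2]
        have hwu' : w <+: u := (List.prefix_append _ _).trans hwu
        refine ih _ ?_ w b rfl hw hwb ⟨y, hy, ?_⟩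
        · rw [← hn, h1]
          simp
        · rcases hyu with h | h
          · exact List.prefix_or_prefix_of_prefix h hwu'
          · exact Or.inr (hwu'.trans h)
    have hI : G.InfoSet 1 {z | G.sim 1 u z} := ⟨u, hu, rfl⟩
    rw [← hv.2.2.2 _ hI _ hσ₁ (Or.inr ⟨I₁, a₁, rfl, y, hy, u, hu, hyu⟩) u hu,
      ← hv.2.2.2 _ hI none (Or.inl rfl) (Or.inl rfl) u hu] at hparent
    rcases val_eq_zero_or_one hint (some (I₁, a₁)) none with h | h
    · rw [h, zero_mul] at hparent ⊢
      exact (Finset.sum_eq_zero_iff_of_nonneg fun _ _ => val_nonneg hv _ _).1 hparent a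
        (G.mem_actions.2 ha)
    · rw [h, one_mul] at hparent ⊢
      exact (Finset.sum_eq_sum_iff_of_le fun _ _ => val_le_val_none hpr hv _ _).1 hparent a
        (G.mem_actions.2 ha)

theorem corrMap_pointMass (q : PlanT × PlanT) (p : G.Idx) :
    G.corrMap (pointMass q) p =
      if q.1 ∈ G.PlanSet 0 p.1.1 ∧ q.2 ∈ G.PlanSet 1 p.1.2 then 1 else 0 := by
  rw [corrMap, finsum_eq_single _ q]
  · rw [finsum_eq_if]
    simp [pointMass]
  · intro r hr
    simp [pointMass, hr]

theorem isDist_pointMass {π₁ π₂ : PlanT} (h₁ : G.IsPlan 0 π₁) (h₂ : G.IsPlan 1 π₂) :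
    G.IsDist (pointMass (π₁, π₂)) := by
  refine ⟨fun q => ?_, (Set.finite_singleton (π₁, π₂)).subset fun q hq => ?_, fun q hq => ?_, ?_⟩
  · unfold pointMass
    split_ifs <;> simp
  · by_contra hne
    exact hq (if_neg hne)
  · obtain rfl : q = (π₁, π₂) := by
      by_contra hne
      exact hq (if_neg hne)
    exact ⟨h₁, h₂⟩
  · rw [finsum_eq_single (pointMass (π₁, π₂)) (π₁, π₂) fun q hq => if_neg hq]
    exact if_pos rfl

end EFG

/-- Let `v ∈ 𝒱` have all coordinates in `{0, 1}`.  Then there are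
reduced-normal-form plans `π₁* ∈ Π₁`, `π₂* ∈ Π₂` with `v = f(𝟙_{(π₁*,π₂*)})`; in
particular `v ∈ Ξ`. -/
theorem VSF_zero_one_mem_corrPoly (G : EFG) (hpr : G.PerfectRecall)
    (v : G.Idx → ℝ) (hv : v ∈ G.VSF) (hint : ∀ p : G.Idx, v p = 0 ∨ v p = 1) :
    (∃ π₁ π₂ : PlanT, G.IsPlan 0 π₁ ∧ G.IsPlan 1 π₂ ∧
      v = G.corrMap (pointMass (π₁, π₂))) ∧ v ∈ G.corrPoly := by
  obtain ⟨π₁, h₁, hx⟩ := EFG.exists_isPlan_of_sequenceForm hpr 0 (fun σ => G.val v σ none)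
    hv.2.1 (fun σ => EFG.val_eq_zero_or_one hint σ none)
    (fun I hI u hu => hv.2.2.1 I hI none (Or.inl rfl) (Or.inl rfl) u hu)
  obtain ⟨π₂, h₂, hy⟩ := EFG.exists_isPlan_of_sequenceForm hpr 1 (fun σ => G.val v none σ)
    hv.2.1 (fun σ => EFG.val_eq_zero_or_one hint none σ)
    (fun I hI u hu => hv.2.2.2 I hI none (Or.inl rfl) (Or.inl rfl) u hu)
  have heq : v = G.corrMap (pointMass (π₁, π₂)) := by
    funext p
    have hp : v p = G.val v p.1.1 p.1.2 := by rw [EFG.val, dif_pos p.2]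
    rw [EFG.corrMap_pointMass, hp, EFG.val_eq_mul hpr hv hint p.2,
      ← hx _ p.2.1, ← hy _ p.2.2.1]
    rcases EFG.val_eq_zero_or_one hint p.1.1 none with h | h <;>
      rcases EFG.val_eq_zero_or_one hint none p.1.2 with h' | h' <;> simp [h, h']
  exact ⟨⟨π₁, π₂, h₁, h₂, heq⟩, _, EFG.isDist_pointMass h₁ h₂, heq⟩
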